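/- Let n ∈ ℕ, s ∈ (0,1) and let A be a Young function. Then V^{s,A}(ℝⁿ) → VMO(ℝⁿ) uniformly if and only if there exists c > 0 such that A(t) ≥ c t^{n/s} for all t > 0 and lim_{t→∞} A(t)/t^{n/s} = ∞. -/

import Mathlib

open MeasureTheory Metric Set Filter
open scoped ENNReal Topology

noncomputable section

/-- Euclidean space `ℝⁿ`. -/
abbrev Euc (n : ℕ) := EuclideanSpace ℝ (Fin n)

/-- A Young function: convex, left-continuous, vanishing at `0`,
non-constant on `(0,∞)`, with values in `[0,∞]`. -/
def IsYoung (A : ℝ → ℝ≥0∞) : Prop :=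
  A 0 = 0 ∧
  (∀ x y t : ℝ, 0 ≤ x → 0 ≤ y → 0 ≤ t → t ≤ 1 →
      A (t * x + (1 - t) * y) ≤ ENNReal.ofReal t * A x + ENNReal.ofReal (1 - t) * A y) ∧
  (∀ t : ℝ, 0 < t → ContinuousWithinAt A (Set.Iic t) t) ∧
  (∃ t₁ t₂ : ℝ, 0 < t₁ ∧ 0 < t₂ ∧ A t₁ ≠ A t₂)

/-- The right-continuous generalized inverse of a monotone function `A : [0,∞) → [0,∞]`. -/
def rcInv (A : ℝ → ℝ≥0∞) (v : ℝ≥0∞) : ℝ :=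
  sInf {τ : ℝ | 0 ≤ τ ∧ v < A τ}

/-- The Young conjugate `Ã(t) = sup {τ t - A(τ) : τ ≥ 0}`. -/
def youngConj (A : ℝ → ℝ≥0∞) (t : ℝ) : ℝ≥0∞ :=
  ⨆ (τ : ℝ) (_ : 0 ≤ τ), ENNReal.ofReal (τ * t) - A τ

/-- The functional `J_{σ,A}(v)` for a vector-valued `v`, with the Euclidean norm. -/
def Jfun (n : ℕ) (σ : ℝ) (A : ℝ → ℝ≥0∞) {ι : Type} [Fintype ι]
    (v : Euc n → ι → ℝ) : ℝ≥0∞ :=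
  ∫⁻ x : Euc n, ∫⁻ y : Euc n,
    A (Real.sqrt (∑ i, (v x i - v y i) ^ 2) / ‖x - y‖ ^ σ) /
      ENNReal.ofReal (‖x - y‖ ^ (n : ℝ))

/-- The fractional Orlicz–Sobolev seminorm `|v|_{σ,A,ℝⁿ}` (vector-valued version). -/
def fracSem (n : ℕ) (σ : ℝ) (A : ℝ → ℝ≥0∞) {ι : Type} [Fintype ι]
    (v : Euc n → ι → ℝ) : ℝ≥0∞ :=
  sInf (ENNReal.ofReal '' {lam : ℝ | 0 < lam ∧ Jfun n σ A (fun x i => v x i / lam) ≤ 1})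

/-- The fractional Orlicz–Sobolev seminorm `|u|_{σ,A,ℝⁿ}` of a scalar function. -/
def fracSemS (n : ℕ) (σ : ℝ) (A : ℝ → ℝ≥0∞) (u : Euc n → ℝ) : ℝ≥0∞ :=
  fracSem n σ A (fun x (_ : Fin 1) => u x)

/-- The normalized mean oscillation `φ(|B|^{1/n})⁻¹ ⨍_B |u - u_B|` over the ball `B = B(x,r)`. -/
def oscQuot (n : ℕ) (φ : ℝ → ℝ) (u : Euc n → ℝ) (x : Euc n) (r : ℝ) : ℝ :=
  (φ ((volume (ball x r)).toReal ^ ((n : ℝ)⁻¹)))⁻¹ *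
    ⨍ y in ball x r, |u y - ⨍ z in ball x r, u z|

/-- The Campanato seminorm `|u|_{𝓛^φ(ℝⁿ)}`. -/
def campSem (n : ℕ) (φ : ℝ → ℝ) (u : Euc n → ℝ) : ℝ≥0∞ :=
  ⨆ (x : Euc n) (r : ℝ) (_ : 0 < r), ENNReal.ofReal (oscQuot n φ u x r)

/-- The Campanato quantity restricted to balls of measure at most `r`. -/
def campSemSmall (n : ℕ) (φ : ℝ → ℝ) (u : Euc n → ℝ) (r : ℝ) : ℝ≥0∞ :=
  ⨆ (x : Euc n) (ρ : ℝ) (_ : 0 < ρ) (_ : volume (ball x ρ) ≤ ENNReal.ofReal r),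
    ENNReal.ofReal (oscQuot n φ u x ρ)

/-- `φ : (0,∞) → (0,∞)` is admissible: positive and bounded below away from zero on `[a,∞)`. -/
def Admissible (φ : ℝ → ℝ) : Prop :=
  (∀ r : ℝ, 0 < r → 0 < φ r) ∧
  ∀ a : ℝ, 0 < a → ∃ ε : ℝ, 0 < ε ∧ ∀ r : ℝ, a ≤ r → ε ≤ φ r

/-- `φ_{s,A}(r) = r^s A⁻¹(r^{-n})`. -/
def phiSA (n : ℕ) (s : ℝ) (A : ℝ → ℝ≥0∞) (r : ℝ) : ℝ :=
  r ^ s * rcInv A (ENNReal.ofReal (r ^ (-(n : ℝ))))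

/-- `u` is `m`-times weakly differentiable, with iterated weak partial
derivatives recorded by `D`. -/
def HasWeakDerivs (n m : ℕ) (u : Euc n → ℝ)
    (D : (h : ℕ) → Euc n → (Fin h → Fin n) → ℝ) : Prop :=
  (∀ x d, D 0 x d = u x) ∧
  ∀ h : ℕ, h ≤ m → ∀ dirs : Fin h → Fin n,
    LocallyIntegrable (fun x => D h x dirs) volume ∧
    ∀ φ : Euc n → ℝ, ContDiff ℝ (⊤ : ℕ∞) φ → HasCompactSupport φ →
      ∫ x : Euc n, u x *
          iteratedFDeriv ℝ h φ x (fun i => EuclideanSpace.single (dirs i) (1 : ℝ)) =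
        (-1 : ℝ) ^ h * ∫ x : Euc n, D h x dirs * φ x

/-- The Euclidean length `|∇^h u|(x)` of the `h`-th order weak gradient. -/
def gradLen (n : ℕ) (D : (h : ℕ) → Euc n → (Fin h → Fin n) → ℝ) (h : ℕ) (x : Euc n) : ℝ :=
  Real.sqrt (∑ d : Fin h → Fin n, (D h x d) ^ 2)

/-- The derivatives of orders `k, …, m` decay near infinity:
`|{|∇^h u| > t}| < ∞` for every `t > 0`. -/
def DecayFrom (n k m : ℕ) (D : (h : ℕ) → Euc n → (Fin h → Fin n) → ℝ) : Prop :=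
  ∀ h : ℕ, k ≤ h → h ≤ m → ∀ t : ℝ, 0 < t →
    volume {x : Euc n | t < gradLen n D h x} < ⊤

/-- The Young function `F_k(t) = t^{n/(n-s+k+1)} ∫_0^t Ã(τ) τ^{-1-n/(n-s+k+1)} dτ`. -/
def Fk (n : ℕ) (s : ℝ) (k : ℕ) (A : ℝ → ℝ≥0∞) (t : ℝ) : ℝ≥0∞ :=
  ENNReal.ofReal (t ^ ((n : ℝ) / ((n : ℝ) - s + (k : ℝ) + 1))) *
    ∫⁻ τ in Set.Ioc (0 : ℝ) t,
      youngConj A τ * ENNReal.ofReal (τ ^ (-1 - (n : ℝ) / ((n : ℝ) - s + (k : ℝ) + 1)))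

/-- `ψ^k_{s,A}(r) = 1 / (r^{n-s+k} F_k⁻¹(r^{-n}))`. -/
def psiK (n : ℕ) (s : ℝ) (k : ℕ) (A : ℝ → ℝ≥0∞) (r : ℝ) : ℝ :=
  (r ^ ((n : ℝ) - s + (k : ℝ)) * rcInv (Fk n s k A) (ENNReal.ofReal (r ^ (-(n : ℝ)))))⁻¹

/-- `ψ^{[s]}_{s,A}(r) = r^{{s}} A⁻¹(r^{-n})`. -/
def psiTop (n : ℕ) (s : ℝ) (A : ℝ → ℝ≥0∞) (r : ℝ) : ℝ :=
  r ^ (s - (⌊s⌋₊ : ℝ)) * rcInv A (ENNReal.ofReal (r ^ (-(n : ℝ))))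

/-- Convergence near zero of `∫_0 (t/A(t))^{(s-(k+1))/(n-(s-(k+1)))} dt`. -/
def IntCondK (n : ℕ) (s : ℝ) (k : ℕ) (A : ℝ → ℝ≥0∞) : Prop :=
  ∃ ε : ℝ, 0 < ε ∧
    ∫⁻ t in Set.Ioc (0 : ℝ) ε,
      (ENNReal.ofReal t / A t) ^ ((s - (k : ℝ) - 1) / ((n : ℝ) - (s - (k : ℝ) - 1))) < ⊤

/-- `P` is the projection polynomial `P^k_B[u]`: it has degree at most `k` and its
derivatives up to order `k` match, in the mean over `B`, the weak derivatives `D` of `u`. -/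
def IsCampPoly (n k : ℕ) (D : (h : ℕ) → Euc n → (Fin h → Fin n) → ℝ)
    (B : Set (Euc n)) (P : MvPolynomial (Fin n) ℝ) : Prop :=
  P.totalDegree ≤ k ∧
  ∀ h : ℕ, h ≤ k → ∀ dirs : Fin h → Fin n,
    ∫ x in B, D h x dirs =
      ∫ x in B,
        iteratedFDeriv ℝ h (fun y : Euc n => MvPolynomial.eval (fun i => y i) P) x
          (fun i => EuclideanSpace.single (dirs i) (1 : ℝ))

/-- The normalized oscillation of order `k` over the ball `B(x,r)`. -/
def oscQuotK (n k : ℕ) (φ : ℝ → ℝ) (u : Euc n → ℝ)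
    (D : (h : ℕ) → Euc n → (Fin h → Fin n) → ℝ) (x : Euc n) (r : ℝ) : ℝ≥0∞ :=
  ⨅ (P : MvPolynomial (Fin n) ℝ) (_ : IsCampPoly n k D (ball x r) P),
    ENNReal.ofReal
      ((φ ((volume (ball x r)).toReal ^ ((n : ℝ)⁻¹)) *
          (volume (ball x r)).toReal ^ ((k : ℝ) / (n : ℝ)))⁻¹ *
        ⨍ y in ball x r, |u y - MvPolynomial.eval (fun i => y i) P|)

/-- The `k`-th order Campanato seminorm `|u|_{𝓛^{k,φ}(ℝⁿ)}`. -/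
def campSemK (n k : ℕ) (φ : ℝ → ℝ) (u : Euc n → ℝ)
    (D : (h : ℕ) → Euc n → (Fin h → Fin n) → ℝ) : ℝ≥0∞ :=
  ⨆ (x : Euc n) (r : ℝ) (_ : 0 < r), oscQuotK n k φ u D x r

/-- The `k`-th order Campanato quantity restricted to balls of measure at most `r`. -/
def campSemKSmall (n k : ℕ) (φ : ℝ → ℝ) (u : Euc n → ℝ)
    (D : (h : ℕ) → Euc n → (Fin h → Fin n) → ℝ) (r : ℝ) : ℝ≥0∞ :=
  ⨆ (x : Euc n) (ρ : ℝ) (_ : 0 < ρ) (_ : volume (ball x ρ) ≤ ENNReal.ofReal r),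
    oscQuotK n k φ u D x ρ

/-- The Luxemburg norm `‖f‖_{L^A(μ)}`. -/
def luxNorm {α : Type*} [MeasurableSpace α] (A : ℝ → ℝ≥0∞) (μ : Measure α)
    (f : α → ℝ) : ℝ≥0∞ :=
  sInf (ENNReal.ofReal '' {lam : ℝ | 0 < lam ∧ ∫⁻ x, A (|f x| / lam) ∂μ ≤ 1})

/-- Iterated integral `∫_r^∞ ∫_{r_1}^∞ ⋯ g`. -/
def iterInt : ℕ → (ℝ → ℝ) → (ℝ → ℝ)
  | 0, g => g
  | j + 1, g => fun r => ∫ t in Set.Ioi r, iterInt j g t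

end
theorem IsYoung.apply_mul_le {A : ℝ → ℝ≥0∞} (hA : IsYoung A) {t x : ℝ} (ht : 0 ≤ t) (ht1 : t ≤ 1)
    (hx : 0 ≤ x) : A (t * x) ≤ ENNReal.ofReal t * A x := by
  simpa [hA.1] using hA.2.1 x 0 t hx le_rfl ht ht1

theorem IsYoung.mono {A : ℝ → ℝ≥0∞} (hA : IsYoung A) {x y : ℝ} (hx : 0 ≤ x) (hxy : x ≤ y) :
    A x ≤ A y := by
  rcases hx.eq_or_lt with rfl | hx
  · simp [hA.1]
  have hy := hx.trans_le hxy
  have h1 : x / y ≤ 1 := (div_le_one hy).2 hxy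
  calc A x = A (x / y * y) := by rw [div_mul_cancel₀ _ hy.ne']
    _ ≤ ENNReal.ofReal (x / y) * A y := hA.apply_mul_le (by positivity) h1 hy.le
    _ ≤ 1 * A y := by gcongr; simpa using h1
    _ = A y := one_mul _

theorem Jfun_scalar (n : ℕ) (σ : ℝ) (A : ℝ → ℝ≥0∞) (u : Euc n → ℝ) :
    Jfun n σ A (fun x (_ : Fin 1) => u x) =
      ∫⁻ x : Euc n, ∫⁻ y : Euc n,
        A (|u x - u y| / ‖x - y‖ ^ σ) / ENNReal.ofReal (‖x - y‖ ^ (n : ℝ)) := by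
  simp [Jfun, Real.sqrt_sq_eq_abs]

theorem volume_ball_real {n : ℕ} (x : Euc n) {ρ : ℝ} (hρ : 0 < ρ) :
    volume.real (ball x ρ) = ρ ^ n * volume.real (ball (0 : Euc n) 1) := by
  rw [measureReal_def, Measure.addHaar_ball_of_pos _ _ hρ, ENNReal.toReal_mul,
    ENNReal.toReal_ofReal (by positivity), finrank_euclideanSpace, Fintype.card_fin]
  rfl

theorem volume_real_unitBall_pos (n : ℕ) : 0 < volume.real (ball (0 : Euc n) 1) :=
  ENNReal.toReal_pos (measure_ball_pos _ _ one_pos).ne' measure_ball_lt_top.ne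

/-- The mean oscillation is bounded by the double average of the differences. -/
theorem ofReal_oscQuot_one_le {n : ℕ} {u : Euc n → ℝ} (hum : Measurable u) (x : Euc n)
    {ρ : ℝ} (hρ : 0 < ρ) :
    ENNReal.ofReal (oscQuot n (fun _ => 1) u x ρ) ≤
      (volume (ball x ρ))⁻¹ * ((volume (ball x ρ))⁻¹ *
        ∫⁻ y in ball x ρ, ∫⁻ z in ball x ρ, ENNReal.ofReal |u y - u z|) := by
  have hV0 : volume (ball x ρ) ≠ 0 := (measure_ball_pos _ _ hρ).ne'
  have hVt : volume (ball x ρ) ≠ ⊤ := measure_ball_lt_top.ne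
  have hinv : ENNReal.ofReal (volume.real (ball x ρ))⁻¹ = (volume (ball x ρ))⁻¹ := by
    rw [measureReal_def, ENNReal.ofReal_inv_of_pos (ENNReal.toReal_pos hV0 hVt),
      ENNReal.ofReal_toReal hVt]
  have : IsFiniteMeasure (volume.restrict (ball x ρ)) := ⟨by simpa using hVt.lt_top⟩
  set m := ⨍ z in ball x ρ, u z with hm
  by_cases hu : IntegrableOn u (ball x ρ)
  · have key : ∀ y, ‖|u y - m|‖ₑ ≤
        (volume (ball x ρ))⁻¹ * ∫⁻ z in ball x ρ, ENNReal.ofReal |u y - u z| := by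
      intro y
      have h1 : u y - m = (volume.real (ball x ρ))⁻¹ * ∫ z in ball x ρ, (u y - u z) := by
        have hv : volume.real (ball x ρ) ≠ 0 := (ENNReal.toReal_pos hV0 hVt).ne'
        rw [integral_sub (integrable_const _) hu, hm, setAverage_eq]
        simp only [integral_const, smul_eq_mul, measureReal_restrict_apply_univ]
        field_simp
      rw [Real.enorm_abs, h1, enorm_mul, ← hinv, Real.enorm_eq_ofReal (by positivity)]
      gcongr
      refine (enorm_integral_le_lintegral_enorm _).trans_eq ?_
      simp [Real.enorm_eq_ofReal_abs]
    have h2 : oscQuot n (fun _ => 1) u x ρ =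
        (volume.real (ball x ρ))⁻¹ * ∫ y in ball x ρ, |u y - m| := by
      simp only [oscQuot, inv_one, one_mul, ← hm]
      rw [setAverage_eq, smul_eq_mul]
    rw [h2, ENNReal.ofReal_mul (by positivity), hinv]
    gcongr
    rw [← lintegral_const_mul' _ _ (ENNReal.inv_ne_top.2 hV0)]
    calc ENNReal.ofReal (∫ y in ball x ρ, |u y - m|)
        ≤ ‖∫ y in ball x ρ, |u y - m|‖ₑ := by
          rw [Real.enorm_eq_ofReal_abs]; exact ENNReal.ofReal_le_ofReal (le_abs_self _)
      _ ≤ ∫⁻ y in ball x ρ, ‖|u y - m|‖ₑ := enorm_integral_le_lintegral_enorm _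
      _ ≤ _ := lintegral_mono key
  · have hm0 : m = 0 := by rw [hm, setAverage_eq, integral_undef hu, smul_zero]
    have h : ¬ IntegrableOn (fun y => |u y|) (ball x ρ) := fun h =>
      hu ((integrable_norm_iff hum.aestronglyMeasurable).1 h)
    have h0 : oscQuot n (fun _ => 1) u x ρ = 0 := by
      simp only [oscQuot, ← hm, hm0, sub_zero]
      rw [setAverage_eq, integral_undef h]
      simp
    simp [h0]

/-- Pointwise bound of a difference quotient by the Orlicz integrand, when `A` dominates
`M t ^ (n / s)` beyond `T`. -/
theorem ofReal_le_add_mul_integrand {n : ℕ} {s : ℝ} (hs : 0 < s) (hns : s < n) {A : ℝ → ℝ≥0∞}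
    {T M ε d R w : ℝ} (hT : 0 ≤ T) (hM : 0 < M) (hε : 0 < ε)
    (hA : ∀ t, T < t → ENNReal.ofReal (M * t ^ ((n : ℝ) / s)) ≤ A t)
    (hd : 0 < d) (hdR : d ≤ R) (hw : 0 ≤ w) :
    ENNReal.ofReal w ≤ ENNReal.ofReal (T * R ^ s + ε) +
      ENNReal.ofReal (R ^ (2 * n) / (M * ε ^ ((n : ℝ) / s - 1))) *
        (A (w / d ^ s) / ENNReal.ofReal (d ^ (n : ℝ))) := by
  set p := (n : ℝ) / s with hp
  have hp1 : 1 < p := by rw [hp, lt_div_iff₀ hs]; simpa using hns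
  have hR : 0 < R := hd.trans_le hdR
  have hTR : 0 ≤ T * R ^ s := by positivity
  rcases le_or_gt (w / d ^ s) T with hDT | hDT
  · refine le_add_right (ENNReal.ofReal_le_ofReal ?_)
    rw [div_le_iff₀ (by positivity)] at hDT
    have : T * d ^ s ≤ T * R ^ s := by gcongr
    linarith
  rcases le_or_gt w ε with hwε | hwε
  · exact le_add_right (ENNReal.ofReal_le_ofReal (by linarith))
  refine le_add_left ?_
  have hw0 : 0 < w := hε.trans hwε
  have hDp : (w / d ^ s) ^ p = w ^ p / d ^ n := by
    rw [Real.div_rpow hw (by positivity), ← Real.rpow_mul hd.le, hp, mul_div_cancel₀ _ hs.ne',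
      Real.rpow_natCast]
  calc ENNReal.ofReal w
      ≤ ENNReal.ofReal (R ^ (2 * n) / (M * ε ^ (p - 1)) * (M * (w / d ^ s) ^ p / d ^ (n : ℝ))) := by
        apply ENNReal.ofReal_le_ofReal
        have h1 : w * ε ^ (p - 1) ≤ w ^ p := by
          calc w * ε ^ (p - 1) ≤ w * w ^ (p - 1) := by
                gcongr
            _ = w ^ p := by
                rw [mul_comm, ← Real.rpow_add_one hw0.ne', sub_add_cancel]
        have h2 : d ^ (2 * n) ≤ R ^ (2 * n) := by gcongr
        rw [hDp, Real.rpow_natCast]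
        have h3 : R ^ (2 * n) / (M * ε ^ (p - 1)) * (M * (w ^ p / d ^ n) / d ^ n) =
            (R ^ (2 * n) / d ^ (2 * n)) * (w ^ p / ε ^ (p - 1)) := by
          have : 0 < ε ^ (p - 1) := by positivity
          field_simp
          ring
        rw [h3]
        have h4 : 1 ≤ R ^ (2 * n) / d ^ (2 * n) := (one_le_div (by positivity)).2 h2
        have h5 : w ≤ w ^ p / ε ^ (p - 1) := (le_div_iff₀ (by positivity)).2 h1
        nlinarith
    _ = ENNReal.ofReal (R ^ (2 * n) / (M * ε ^ (p - 1))) *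
        (ENNReal.ofReal (M * (w / d ^ s) ^ p) / ENNReal.ofReal (d ^ (n : ℝ))) := by
        rw [ENNReal.ofReal_mul (by positivity), 
          ENNReal.ofReal_div_of_pos (show 0 < d ^ (n : ℝ) by positivity)]
    _ ≤ _ := by gcongr; exact hA _ hDT

/-- Mean oscillation bound on a ball of radius `ρ`, when `A` dominates `M t ^ (n / s)`
beyond `T`. -/
theorem ofReal_oscQuot_one_le_of_growth {n : ℕ} {s : ℝ} (hs : 0 < s) (hns : s < n)
    {A : ℝ → ℝ≥0∞} {T M ε lam ρ : ℝ} (hT : 0 ≤ T) (hM : 0 < M) (hε : 0 < ε)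
    (hA : ∀ t, T < t → ENNReal.ofReal (M * t ^ ((n : ℝ) / s)) ≤ A t)
    {u : Euc n → ℝ} (hum : Measurable u) (hlam : 0 < lam)
    (hJ : Jfun n s A (fun x (_ : Fin 1) => u x / lam) ≤ 1) (x : Euc n) (hρ : 0 < ρ) :
    ENNReal.ofReal (oscQuot n (fun _ => 1) u x ρ) ≤
      ENNReal.ofReal (lam * (T * (2 * ρ) ^ s + ε +
        4 ^ n / volume.real (ball (0 : Euc n) 1) ^ 2 / (M * ε ^ ((n : ℝ) / s - 1)))) := by
  set ω := volume.real (ball (0 : Euc n) 1) with hω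
  have hω0 : 0 < ω := volume_real_unitBall_pos n
  set c₁ := T * (2 * ρ) ^ s + ε with hc₁
  have hc₁0 : 0 < c₁ := by positivity
  set c₂ := (2 * ρ) ^ (2 * n) / (M * ε ^ ((n : ℝ) / s - 1)) with hc₂
  have hc₂0 : 0 < c₂ := by positivity
  set B := ball x ρ with hB
  have hV : volume B = ENNReal.ofReal (ρ ^ n * ω) := by
    rw [← volume_ball_real x hρ, ofReal_measureReal measure_ball_lt_top.ne]
  rw [Jfun_scalar n s A (fun x => u x / lam)] at hJ
  set F : Euc n → Euc n → ℝ≥0∞ := fun y z =>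
    A (|u y / lam - u z / lam| / ‖y - z‖ ^ s) / ENNReal.ofReal (‖y - z‖ ^ (n : ℝ)) with hF
  have hpt : ∀ y ∈ B, ∀ z ∈ B, ENNReal.ofReal |u y - u z| ≤
      ENNReal.ofReal lam * (ENNReal.ofReal c₁ + ENNReal.ofReal c₂ * F y z) := by
    intro y hy z hz
    rcases eq_or_ne y z with rfl | hyz
    · simp
    have hd : 0 < ‖y - z‖ := norm_pos_iff.2 (sub_ne_zero.2 hyz)
    have hdR : ‖y - z‖ ≤ 2 * ρ := by
      rw [← dist_eq_norm]
      have := dist_triangle_right y z x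
      have h1 := mem_ball.1 hy
      have h2 := mem_ball.1 hz
      linarith
    have h := ofReal_le_add_mul_integrand hs hns hT hM hε hA hd hdR
      (abs_nonneg (u y / lam - u z / lam))
    calc ENNReal.ofReal |u y - u z|
        = ENNReal.ofReal lam * ENNReal.ofReal |u y / lam - u z / lam| := by
          rw [← ENNReal.ofReal_mul hlam.le, ← sub_div, abs_div, abs_of_pos hlam,
            mul_div_cancel₀ _ hlam.ne']
      _ ≤ _ := by gcongr
  have hint : ∫⁻ y in B, ∫⁻ z in B, ENNReal.ofReal |u y - u z| ≤
      ENNReal.ofReal lam * (ENNReal.ofReal c₁ * volume B * volume B + ENNReal.ofReal c₂) := by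
    calc ∫⁻ y in B, ∫⁻ z in B, ENNReal.ofReal |u y - u z|
        ≤ ∫⁻ y in B, ∫⁻ z in B,
          ENNReal.ofReal lam * (ENNReal.ofReal c₁ + ENNReal.ofReal c₂ * F y z) :=
          setLIntegral_mono' measurableSet_ball fun y hy =>
            setLIntegral_mono' measurableSet_ball fun z hz => hpt y hy z hz
      _ = ENNReal.ofReal lam * (ENNReal.ofReal c₁ * volume B * volume B +
          ENNReal.ofReal c₂ * ∫⁻ y in B, ∫⁻ z in B, F y z) := by
          simp_rw [lintegral_const_mul' _ _ ENNReal.ofReal_ne_top,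
            lintegral_add_left measurable_const, lintegral_const_mul' _ _ ENNReal.ofReal_ne_top]
          simp
      _ ≤ ENNReal.ofReal lam * (ENNReal.ofReal c₁ * volume B * volume B +
          ENNReal.ofReal c₂ * 1) := by
          gcongr
          refine le_trans ?_ hJ
          exact (setLIntegral_le_lintegral _ _).trans
            (lintegral_mono fun y => setLIntegral_le_lintegral _ _)
      _ = _ := by rw [mul_one]
  have hv : 0 < ρ ^ n * ω := by positivity
  calc ENNReal.ofReal (oscQuot n (fun _ => 1) u x ρ)
      ≤ (volume B)⁻¹ * ((volume B)⁻¹ *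
        (ENNReal.ofReal lam * (ENNReal.ofReal c₁ * volume B * volume B + ENNReal.ofReal c₂))) :=
        (ofReal_oscQuot_one_le hum x hρ).trans (by gcongr)
    _ = ENNReal.ofReal ((ρ ^ n * ω)⁻¹ * ((ρ ^ n * ω)⁻¹ *
        (lam * (c₁ * (ρ ^ n * ω) * (ρ ^ n * ω) + c₂)))) := by
        rw [hV, ← ENNReal.ofReal_inv_of_pos hv, ← ENNReal.ofReal_mul hc₁0.le,
          ← ENNReal.ofReal_mul (by positivity), ← ENNReal.ofReal_add (by positivity) hc₂0.le,
          ← ENNReal.ofReal_mul hlam.le, ← ENNReal.ofReal_mul (by positivity),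
          ← ENNReal.ofReal_mul (by positivity)]
    _ = _ := by
        congr 1
        have h4 : (4 : ℝ) ^ n = 2 ^ (2 * n) := by rw [pow_mul]; norm_num
        have : 0 < ε ^ ((n : ℝ) / s - 1) := by positivity
        rw [hc₂, h4, mul_pow]
        field_simp
        ring

/-- The radial kernel controlling the energy of a Lipschitz bump. -/
noncomputable def bumpKernel (n : ℕ) (s t : ℝ) : ℝ :=
  min (t ^ (1 - s - n)) (t ^ (-s - n))

theorem bumpKernel_nonneg (n : ℕ) (s : ℝ) {t : ℝ} (ht : 0 ≤ t) : 0 ≤ bumpKernel n s t :=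
  le_min (by positivity) (by positivity)

@[fun_prop]
theorem measurable_bumpKernel (n : ℕ) (s : ℝ) : Measurable (bumpKernel n s) := by
  unfold bumpKernel; fun_prop

theorem integrable_bumpKernel_norm {n : ℕ} (hn : 0 < n) {s : ℝ} (hs : s ∈ Ioo (0 : ℝ) 1) :
    Integrable (fun x : Euc n => bumpKernel n s ‖x‖) := by
  have : Nonempty (Fin n) := ⟨⟨0, hn⟩⟩
  rw [integrable_fun_norm_addHaar volume (f := bumpKernel n s), finrank_euclideanSpace,
    Fintype.card_fin, ← Ioc_union_Ioi_eq_Ioi zero_le_one]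
  have hm : Measurable fun y : ℝ => y ^ (n - 1) • bumpKernel n s y := by
    simp only [smul_eq_mul]; fun_prop
  have hpow : ∀ y : ℝ, 0 < y → ∀ a : ℝ, y ^ (n - 1) * y ^ (a - n) = y ^ (a - 1) := by
    intro y hy a
    rw [← Real.rpow_natCast, ← Real.rpow_add hy, Nat.cast_pred hn]
    congr 1; ring
  have hnn : ∀ y : ℝ, 0 < y → 0 ≤ y ^ (n - 1) * bumpKernel n s y := fun y hy =>
    mul_nonneg (by positivity) (bumpKernel_nonneg n s hy.le)
  refine IntegrableOn.union ?_ ?_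
  · have h : IntegrableOn (fun y : ℝ => y ^ (1 - s - 1)) (Ioc 0 1) :=
      (intervalIntegrable_iff_integrableOn_Ioc_of_le zero_le_one).1
        (intervalIntegral.intervalIntegrable_rpow' (by linarith [hs.2]))
    refine Integrable.mono' h hm.aestronglyMeasurable ?_
    refine (ae_restrict_iff' measurableSet_Ioc).2 (.of_forall fun y hy => ?_)
    rw [smul_eq_mul, Real.norm_of_nonneg (hnn y hy.1), ← hpow y hy.1]
    have := hy.1
    gcongr
    exact min_le_left _ _
  · have h : IntegrableOn (fun y : ℝ => y ^ (-s - 1)) (Ioi 1) :=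
      integrableOn_Ioi_rpow_of_lt (by linarith [hs.1]) one_pos
    refine Integrable.mono' h hm.aestronglyMeasurable ?_
    refine (ae_restrict_iff' measurableSet_Ioi).2 (.of_forall fun y hy => ?_)
    have hy : 0 < y := one_pos.trans hy
    rw [smul_eq_mul, Real.norm_of_nonneg (hnn y hy), ← hpow y hy]
    gcongr
    exact min_le_right _ _

theorem lintegral_bumpKernel_scaled {n : ℕ} (hn : 0 < n) {s : ℝ} (hs : s ∈ Ioo (0 : ℝ) 1)
    {r : ℝ} (hr : 0 < r) :
    ∫⁻ x : Euc n, ENNReal.ofReal ((r ^ n)⁻¹ * bumpKernel n s (r⁻¹ * ‖x‖)) =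
      ENNReal.ofReal (∫ x : Euc n, bumpKernel n s ‖x‖) := by
  have hnorm : ∀ x : Euc n, r⁻¹ * ‖x‖ = ‖r⁻¹ • x‖ := fun x => by
    rw [norm_smul, Real.norm_of_nonneg (by positivity)]
  simp_rw [hnorm]
  have hint := integrable_bumpKernel_norm hn hs
  rw [← ofReal_integral_eq_lintegral_ofReal]
  · congr 1
    rw [integral_const_mul,
      Measure.integral_comp_smul_of_nonneg volume (fun x : Euc n => bumpKernel n s ‖x‖) r⁻¹
        (hR := by positivity), finrank_euclideanSpace, Fintype.card_fin, smul_eq_mul]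
    have : r ^ n ≠ 0 := by positivity
    rw [inv_pow, inv_inv, inv_mul_cancel_left₀ this]
  · exact ((integrable_comp_smul_iff volume _ (inv_ne_zero hr.ne')).2 hint).const_mul _
  · refine .of_forall fun x => ?_
    exact mul_nonneg (by positivity) (bumpKernel_nonneg n s (norm_nonneg _))

/-- The Lipschitz tent function on the unit ball. -/
noncomputable def tent (n : ℕ) (x : Euc n) : ℝ := max 0 (1 - ‖x‖)

@[fun_prop]
theorem continuous_tent (n : ℕ) : Continuous (tent n) := by
  unfold tent; fun_prop

theorem tent_eq_zero {n : ℕ} {x : Euc n} (hx : 1 ≤ ‖x‖) : tent n x = 0 :=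
  max_eq_left (by linarith)

theorem abs_tent_sub_le (n : ℕ) (x y : Euc n) : |tent n x - tent n y| ≤ min ‖x - y‖ 1 := by
  refine le_min ?_ ?_
  · calc |tent n x - tent n y| ≤ |(1 - ‖x‖) - (1 - ‖y‖)| := by
          simpa only [tent, max_comm (0 : ℝ)] using abs_max_sub_max_le_abs (1 - ‖x‖) (1 - ‖y‖) 0
      _ = |‖y‖ - ‖x‖| := by congr 1; ring
      _ ≤ ‖x - y‖ := by rw [norm_sub_rev]; exact abs_norm_sub_norm_le y x
  · have h : ∀ z : Euc n, 0 ≤ tent n z ∧ tent n z ≤ 1 := fun z =>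
      ⟨le_max_left _ _, max_le zero_le_one (by linarith [norm_nonneg z])⟩
    rw [abs_le]
    constructor <;> linarith [(h x).1, (h x).2, (h y).1, (h y).2]

/-- The rescaled tent of radius `r` and height `a r ^ s`. -/
noncomputable def scaledTent (n : ℕ) (s a r : ℝ) (x : Euc n) : ℝ := a * r ^ s * tent n (r⁻¹ • x)

theorem measurable_scaledTent (n : ℕ) (s a r : ℝ) : Measurable (scaledTent n s a r) := by
  unfold scaledTent
  exact Continuous.measurable (by fun_prop)

theorem integrand_scaledTent_le {n : ℕ} {s : ℝ} (hs : s ∈ Ioo (0 : ℝ) 1)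
    {A : ℝ → ℝ≥0∞} (hA : IsYoung A) {a r : ℝ} (ha : 0 < a) (hr : 0 < r) (x y : Euc n) :
    A (|scaledTent n s a r x - scaledTent n s a r y| / ‖x - y‖ ^ s) /
        ENNReal.ofReal (‖x - y‖ ^ (n : ℝ)) ≤
      A a * ((ball (0 : Euc n) r).indicator 1 x *
          ENNReal.ofReal ((r ^ n)⁻¹ * bumpKernel n s (r⁻¹ * ‖x - y‖)) +
        (ball (0 : Euc n) r).indicator 1 y *
          ENNReal.ofReal ((r ^ n)⁻¹ * bumpKernel n s (r⁻¹ * ‖x - y‖))) := by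
  rcases eq_or_ne (scaledTent n s a r x) (scaledTent n s a r y) with h | h
  · simp [h, hA.1]
  have hd : 0 < ‖x - y‖ := norm_pos_iff.2 (sub_ne_zero.2 fun hxy => h (by rw [hxy]))
  have hout : ∀ z : Euc n, z ∉ ball (0 : Euc n) r → scaledTent n s a r z = 0 := by
    intro z hz
    have hz : r ≤ ‖z‖ := by simpa using hz
    rw [scaledTent, tent_eq_zero, mul_zero]
    rwa [norm_smul, Real.norm_of_nonneg (by positivity), inv_mul_eq_div, one_le_div hr]
  set t := r⁻¹ * ‖x - y‖ with ht
  have ht0 : 0 < t := by positivity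
  have hnt : ‖r⁻¹ • x - r⁻¹ • y‖ = t := by
    rw [← smul_sub, norm_smul, Real.norm_of_nonneg (by positivity)]
  have hxy : ‖x - y‖ = r * t := by rw [ht]; field_simp
  set g := min (t ^ (1 - s)) (t ^ (-s)) with hg
  have hg0 : 0 ≤ g := le_min (by positivity) (by positivity)
  have hg1 : g ≤ 1 := by
    rcases le_total t 1 with h1 | h1
    · exact (min_le_left _ _).trans (Real.rpow_le_one ht0.le h1 (by linarith [hs.2]))
    · exact (min_le_right _ _).trans
        (Real.rpow_le_one_of_one_le_of_nonpos h1 (by linarith [hs.1]))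
  have hquot : |scaledTent n s a r x - scaledTent n s a r y| / ‖x - y‖ ^ s ≤ g * a := by
    have h1 : |scaledTent n s a r x - scaledTent n s a r y| ≤ a * r ^ s * min t 1 := by
      rw [scaledTent, scaledTent, ← mul_sub, abs_mul, abs_of_pos (by positivity), ← hnt]
      gcongr
      exact abs_tent_sub_le n _ _
    have h2 : min t 1 = g * t ^ s := by
      rw [hg, min_mul_of_nonneg _ _ (by positivity), ← Real.rpow_add ht0, ← Real.rpow_add ht0]
      simp
    rw [div_le_iff₀ (by positivity), hxy, Real.mul_rpow hr.le ht0.le]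
    calc _ ≤ _ := h1
      _ = _ := by rw [h2]; ring
  have hker : g / ‖x - y‖ ^ (n : ℝ) = (r ^ n)⁻¹ * bumpKernel n s t := by
    have h1 : bumpKernel n s t = g * t ^ (-(n : ℝ)) := by
      rw [hg, min_mul_of_nonneg _ _ (by positivity), ← Real.rpow_add ht0, ← Real.rpow_add ht0]
      rfl
    rw [h1, hxy, Real.rpow_natCast, mul_pow, Real.rpow_neg ht0.le, Real.rpow_natCast]
    field_simp
  have hmain : A (|scaledTent n s a r x - scaledTent n s a r y| / ‖x - y‖ ^ s) /
        ENNReal.ofReal (‖x - y‖ ^ (n : ℝ)) ≤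
      A a * ENNReal.ofReal ((r ^ n)⁻¹ * bumpKernel n s t) := by
    rw [← hker, ENNReal.ofReal_div_of_pos (by positivity), ← mul_div_assoc, mul_comm (A a)]
    gcongr
    exact (hA.mono (by positivity) hquot).trans (hA.apply_mul_le hg0 hg1 ha.le)
  refine hmain.trans ?_
  gcongr
  by_cases hx : x ∈ ball (0 : Euc n) r
  · simp [indicator_of_mem hx]
  · by_cases hy : y ∈ ball (0 : Euc n) r
    · simp [indicator_of_mem hy]
    · exact absurd ((hout x hx).trans (hout y hy).symm) h

theorem lintegral_lintegral_const_mul_add {α : Type*} [MeasurableSpace α] {μ : Measure α}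
    [SFinite μ] (c : ℝ≥0∞) {f g : α → α → ℝ≥0∞} (hf : Measurable (Function.uncurry f))
    (hg : Measurable (Function.uncurry g)) :
    ∫⁻ x, ∫⁻ y, c * (f x y + g x y) ∂μ ∂μ =
      c * (∫⁻ x, ∫⁻ y, f x y ∂μ ∂μ + ∫⁻ x, ∫⁻ y, g x y ∂μ ∂μ) := by
  have h : ∀ x, ∫⁻ y, c * (f x y + g x y) ∂μ =
      c * (∫⁻ y, f x y ∂μ + ∫⁻ y, g x y ∂μ) := fun x => by
    have hfx : Measurable (f x) := hf.comp measurable_prodMk_left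
    have hgx : Measurable (g x) := hg.comp measurable_prodMk_left
    rw [lintegral_const_mul c (f := fun y => f x y + g x y) (hfx.add hgx), lintegral_add_left hfx]
  have hf' : Measurable fun x => ∫⁻ y, f x y ∂μ := hf.lintegral_prod_right
  have hg' : Measurable fun x => ∫⁻ y, g x y ∂μ := hg.lintegral_prod_right
  simp_rw [h]
  rw [lintegral_const_mul c (f := fun x => ∫⁻ y, f x y ∂μ + ∫⁻ y, g x y ∂μ) (hf'.add hg'),
    lintegral_add_left hf']

theorem lintegral_lintegral_indicator_mul_sub {n : ℕ} {H : Euc n → ℝ≥0∞} (hH : Measurable H)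
    (hneg : ∀ z, H (-z) = H z) {B : Set (Euc n)} (hB : MeasurableSet B) (c : ℝ≥0∞) :
    ∫⁻ x : Euc n, ∫⁻ y : Euc n, c * (B.indicator 1 x * H (x - y) + B.indicator 1 y * H (x - y)) =
      c * (2 * (volume B * ∫⁻ z, H z)) := by
  have hsub : Measurable fun q : Euc n × Euc n => H (q.1 - q.2) :=
    hH.comp (measurable_fst.sub measurable_snd)
  have hind : Measurable (B.indicator (1 : Euc n → ℝ≥0∞)) := measurable_one.indicator hB
  have hf : Measurable (Function.uncurry fun x y : Euc n =>
      B.indicator (1 : Euc n → ℝ≥0∞) x * H (x - y)) :=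
    (hind.comp measurable_fst).mul hsub
  have hg : Measurable (Function.uncurry fun x y : Euc n =>
      B.indicator (1 : Euc n → ℝ≥0∞) y * H (x - y)) :=
    (hind.comp measurable_snd).mul hsub
  have hI1 : ∫⁻ x : Euc n, ∫⁻ y : Euc n, B.indicator 1 x * H (x - y) =
      volume B * ∫⁻ z, H z := by
    have h1 : ∀ x : Euc n, ∫⁻ y : Euc n, B.indicator 1 x * H (x - y) =
        B.indicator 1 x * ∫⁻ z, H z := fun x => by
      have hx : Measurable fun y => H (x - y) := hsub.comp measurable_prodMk_left
      have hx' : ∫⁻ y, H (x - y) = ∫⁻ z, H z := lintegral_sub_left_eq_self H x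
      rw [lintegral_const_mul _ hx, hx']
    simp_rw [h1]
    rw [lintegral_mul_const _ hind, lintegral_indicator_one hB]
  have hI2 : ∫⁻ x : Euc n, ∫⁻ y : Euc n, B.indicator 1 y * H (x - y) =
      volume B * ∫⁻ z, H z := by
    rw [lintegral_lintegral_swap hg.aemeasurable, ← hI1]
    refine lintegral_congr fun x => lintegral_congr fun y => ?_
    rw [← neg_sub, hneg]
  rw [lintegral_lintegral_const_mul_add c hf hg, hI1, hI2, two_mul]

/-- Rescaled tents have small energy as soon as `A a` is at most a multiple of `r ^ (-n)`. -/
theorem exists_Jfun_scaledTent_le {n : ℕ} (hn : 0 < n) {s : ℝ} (hs : s ∈ Ioo (0 : ℝ) 1)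
    {A : ℝ → ℝ≥0∞} (hA : IsYoung A) :
    ∃ C : ℝ, 0 < C ∧ ∀ a r : ℝ, 0 < a → 0 < r →
      Jfun n s A (fun x (_ : Fin 1) => scaledTent n s a r x) ≤ A a * ENNReal.ofReal (C * r ^ n) := by
  set K := ∫ x : Euc n, bumpKernel n s ‖x‖ with hK
  have hK0 : 0 ≤ K := integral_nonneg fun x => bumpKernel_nonneg n s (norm_nonneg _)
  set ω := volume.real (ball (0 : Euc n) 1) with hω
  have hω0 : 0 < ω := volume_real_unitBall_pos n
  refine ⟨2 * ω * (K + 1), by positivity, fun a r ha hr => ?_⟩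
  set B := ball (0 : Euc n) r with hB
  have hV : volume B = ENNReal.ofReal (r ^ n * ω) := by
    rw [← volume_ball_real 0 hr, ofReal_measureReal measure_ball_lt_top.ne]
  set H : Euc n → ℝ≥0∞ := fun z =>
    ENNReal.ofReal ((r ^ n)⁻¹ * bumpKernel n s (r⁻¹ * ‖z‖)) with hH
  have hHm : Measurable H := by
    rw [hH]; fun_prop
  have hHint : ∫⁻ z, H z = ENNReal.ofReal K := lintegral_bumpKernel_scaled hn hs hr
  have hHneg : ∀ z, H (-z) = H z := fun z => by simp only [hH, norm_neg]
  calc Jfun n s A (fun x (_ : Fin 1) => scaledTent n s a r x)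
      ≤ ∫⁻ x : Euc n, ∫⁻ y : Euc n,
        A a * (B.indicator 1 x * H (x - y) + B.indicator 1 y * H (x - y)) := by
        rw [Jfun_scalar]
        exact lintegral_mono fun x => lintegral_mono fun y =>
          integrand_scaledTent_le hs hA ha hr x y
    _ = A a * (2 * (volume B * ENNReal.ofReal K)) := by
        rw [lintegral_lintegral_indicator_mul_sub hHm hHneg measurableSet_ball, hHint]
    _ ≤ A a * ENNReal.ofReal (2 * ω * (K + 1) * r ^ n) := by
        rw [hV, ← ENNReal.ofReal_mul (by positivity), two_mul,
          ← ENNReal.ofReal_add (by positivity) (by positivity)]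
        gcongr
        have : 0 < r ^ n * ω := by positivity
        nlinarith

theorem setAverage_ball_comp_inv_smul {n : ℕ} {r : ℝ} (hr : 0 < r) (f : Euc n → ℝ) :
    ⨍ x in ball (0 : Euc n) r, f (r⁻¹ • x) = ⨍ x in ball (0 : Euc n) 1, f x := by
  have hrn : r ^ n ≠ 0 := by positivity
  rw [setAverage_eq, setAverage_eq,
    Measure.setIntegral_comp_smul_of_pos volume f _ (inv_pos.2 hr), _root_.smul_ball (inv_ne_zero hr.ne'),
    volume_ball_real 0 hr, finrank_euclideanSpace, Fintype.card_fin, smul_zero,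
    Real.norm_of_nonneg (by positivity), inv_mul_cancel₀ hr.ne']
  simp only [smul_eq_mul]
  rw [inv_pow, inv_inv, mul_inv, mul_comm (r ^ n)⁻¹, mul_assoc, inv_mul_cancel_left₀ hrn]

theorem setAverage_abs_tent_sub_pos {n : ℕ} (hn : 0 < n) (m : ℝ) :
    0 < ⨍ x in ball (0 : Euc n) 1, |tent n x - m| := by
  have : Nonempty (Fin n) := ⟨⟨0, hn⟩⟩
  rw [setAverage_eq, smul_eq_mul]
  refine mul_pos (inv_pos.2 (volume_real_unitBall_pos n)) ?_
  have hc : Continuous fun x : Euc n => |tent n x - m| := by fun_prop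
  have hi : IntegrableOn (fun x : Euc n => |tent n x - m|) (ball 0 1) :=
    (hc.continuousOn.integrableOn_compact (isCompact_closedBall 0 1)).mono_set
      ball_subset_closedBall
  rw [setIntegral_pos_iff_support_of_nonneg_ae (.of_forall fun x => abs_nonneg _) hi]
  refine (IsOpen.inter (hc.isOpen_support) isOpen_ball).measure_pos volume ?_
  obtain ⟨e, he⟩ := exists_norm_eq (Euc n) (show (0 : ℝ) ≤ 1 / 2 by norm_num)
  by_cases hm : m = 1
  · refine ⟨e, ?_, by simp [he]; norm_num⟩
    simp only [Function.mem_support, tent, he, hm]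
    norm_num
  · refine ⟨0, ?_, by simp⟩
    simp only [Function.mem_support, tent, norm_zero, sub_zero]
    rw [max_eq_right zero_le_one, abs_ne_zero, sub_ne_zero]
    exact Ne.symm hm

/-- The mean oscillation of rescaled tents on their supports. -/
theorem exists_oscQuot_scaledTent {n : ℕ} (hn : 0 < n) (s : ℝ) :
    ∃ c : ℝ, 0 < c ∧ ∀ a r : ℝ, 0 < a → 0 < r →
      oscQuot n (fun _ => 1) (scaledTent n s a r) 0 r = c * (a * r ^ s) := by
  set m := ⨍ z in ball (0 : Euc n) 1, tent n z with hm
  refine ⟨_, setAverage_abs_tent_sub_pos hn m, fun a r ha hr => ?_⟩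
  have hk : 0 < a * r ^ s := by positivity
  have h1 : ⨍ z in ball (0 : Euc n) r, scaledTent n s a r z = a * r ^ s * m := by
    rw [hm, ← setAverage_ball_comp_inv_smul hr, setAverage_eq, setAverage_eq]
    simp only [scaledTent, integral_const_mul, smul_eq_mul]
    ring
  simp only [oscQuot, inv_one, one_mul, h1]
  rw [← setAverage_ball_comp_inv_smul hr (fun x => |tent n x - m|), setAverage_eq, setAverage_eq]
  simp only [scaledTent, ← mul_sub, abs_mul, abs_of_pos ha,
    abs_of_pos (show 0 < r ^ s by positivity), integral_const_mul, smul_eq_mul]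
  ring

theorem fracSemS_le_one {n : ℕ} {s : ℝ} {A : ℝ → ℝ≥0∞} {u : Euc n → ℝ}
    (hJ : Jfun n s A (fun x (_ : Fin 1) => u x) ≤ 1) : fracSemS n s A u ≤ 1 :=
  sInf_le ⟨1, ⟨one_pos, by simpa using hJ⟩, ENNReal.ofReal_one⟩

theorem exists_lt_of_fracSemS_lt {n : ℕ} {s : ℝ} {A : ℝ → ℝ≥0∞} {u : Euc n → ℝ} {b : ℝ≥0∞}
    (h : fracSemS n s A u < b) :
    ∃ lam : ℝ, 0 < lam ∧ Jfun n s A (fun x (_ : Fin 1) => u x / lam) ≤ 1 ∧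
      ENNReal.ofReal lam < b := by
  obtain ⟨_, ⟨lam, ⟨h0, hJ⟩, rfl⟩, hlt⟩ := sInf_lt_iff.1 h
  exact ⟨lam, h0, hJ, hlt⟩

theorem bmo_of_growth {n : ℕ} {s : ℝ} (hs : 0 < s) (hns : s < n) {A : ℝ → ℝ≥0∞} {c : ℝ}
    (hc : 0 < c) (hA : ∀ t : ℝ, 0 < t → ENNReal.ofReal (c * t ^ ((n : ℝ) / s)) ≤ A t) :
    ∃ c' : ℝ, 0 < c' ∧ ∀ u : Euc n → ℝ, Measurable u → fracSemS n s A u < ⊤ →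
      campSem n (fun _ => 1) u ≤ ENNReal.ofReal c' * fracSemS n s A u := by
  have hω := volume_real_unitBall_pos n
  refine ⟨1 + 4 ^ n / volume.real (ball (0 : Euc n) 1) ^ 2 / c, by positivity, ?_⟩
  intro u hu _
  set c' := 1 + 4 ^ n / volume.real (ball (0 : Euc n) 1) ^ 2 / c with hc'
  have hc'0 : 0 < c' := by positivity
  refine iSup_le fun x => iSup_le fun ρ => iSup_le fun hρ => ?_
  refine le_of_forall_gt fun b hb => ?_
  rw [mul_comm, ← ENNReal.lt_div_iff_mul_lt
    (Or.inl (ENNReal.ofReal_pos.2 hc'0).ne') (Or.inl ENNReal.ofReal_ne_top)] at hb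
  obtain ⟨lam, h0, hJ, hlt⟩ := exists_lt_of_fracSemS_lt hb
  rw [ENNReal.lt_div_iff_mul_lt
    (Or.inl (ENNReal.ofReal_pos.2 hc'0).ne') (Or.inl ENNReal.ofReal_ne_top),
    ← ENNReal.ofReal_mul h0.le] at hlt
  refine (ofReal_oscQuot_one_le_of_growth hs hns le_rfl hc one_pos hA hu h0 hJ x hρ).trans_lt ?_
  simpa [hc'] using hlt

theorem vanishing_of_growth {n : ℕ} {s : ℝ} (hs : 0 < s) (hns : s < n)
    {A : ℝ → ℝ≥0∞}
    (hA : Tendsto (fun t : ℝ => A t / ENNReal.ofReal (t ^ ((n : ℝ) / s))) atTop (𝓝 ⊤)) :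
    Tendsto
      (fun r : ℝ => ⨆ (u : Euc n → ℝ) (_ : Measurable u) (_ : fracSemS n s A u ≤ 1),
        campSemSmall n (fun _ => 1) u r)
      (𝓝[>] (0 : ℝ)) (𝓝 0) := by
  have hω := volume_real_unitBall_pos n
  set ω := volume.real (ball (0 : Euc n) 1) with hω'
  refine ENNReal.tendsto_nhds_zero.2 fun e he => ?_
  obtain ⟨e', he'0, he'⟩ : ∃ e' : ℝ, 0 < e' ∧ ENNReal.ofReal e' ≤ e := by
    rcases eq_or_ne e ⊤ with rfl | het
    · exact ⟨1, one_pos, le_top⟩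
    · exact ⟨e.toReal, ENNReal.toReal_pos he.ne' het, ENNReal.ofReal_toReal_le⟩
  set ε := e' / 6 with hε
  have hε0 : 0 < ε := by positivity
  set p := (n : ℝ) / s with hp
  set C := 4 ^ n / ω ^ 2 with hC
  have hC0 : 0 < C := by positivity
  set M := C / ε ^ p with hM
  have hM0 : 0 < M := by positivity
  have hMε : C / (M * ε ^ (p - 1)) = ε := by
    rw [hM, Real.rpow_sub_one hε0.ne']
    field_simp
  obtain ⟨T, hT0, hT⟩ : ∃ T : ℝ, 0 < T ∧ ∀ t, T < t → ENNReal.ofReal (M * t ^ p) ≤ A t := by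
    have h := hA.eventually (lt_mem_nhds (show ENNReal.ofReal M < ⊤ from ENNReal.ofReal_lt_top))
    obtain ⟨T, hT⟩ := eventually_atTop.1 h
    refine ⟨max T 1, by positivity, fun t ht => ?_⟩
    have ht0 : 0 < t := one_pos.trans ((le_max_right _ _).trans_lt ht)
    have h1 := hT t ((le_max_left _ _).trans ht.le)
    rw [ENNReal.ofReal_mul hM0.le]
    exact ENNReal.mul_le_of_le_div h1.le
  -- balls of measure at most `d ^ n * ω` have radius at most `d`
  set d := (ε / T) ^ (s⁻¹) / 2 with hd
  have hd0 : 0 < d := by positivity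
  have hTd : T * (2 * d) ^ s = ε := by
    rw [hd, mul_div_cancel₀ _ two_ne_zero, ← Real.rpow_mul (by positivity),
      inv_mul_cancel₀ hs.ne', Real.rpow_one, mul_div_cancel₀ _ hT0.ne']
  have hmem : Ioo (0 : ℝ) (d ^ n * ω) ∈ 𝓝[>] (0 : ℝ) := Ioo_mem_nhdsGT (by positivity)
  filter_upwards [hmem] with r hr
  refine iSup_le fun u => iSup_le fun hu => iSup_le fun hu1 => ?_
  refine iSup_le fun x => iSup_le fun ρ => iSup_le fun hρ => iSup_le fun hvol => ?_
  have hρd : ρ ≤ d := by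
    by_contra! hlt
    have h1 : volume.real (ball x ρ) ≤ r := ENNReal.toReal_le_of_le_ofReal hr.1.le hvol
    rw [volume_ball_real x hρ] at h1
    have h2 : d ^ n ≤ ρ ^ n := by gcongr
    have h3 := mul_le_mul_of_nonneg_right h2 hω.le
    linarith [hr.2]
  obtain ⟨lam, h0, hJ, hlt⟩ := exists_lt_of_fracSemS_lt
    (hu1.trans_lt (ENNReal.one_lt_ofReal.2 one_lt_two))
  have hlam : lam < 2 := (ENNReal.ofReal_lt_ofReal_iff two_pos).1 hlt
  refine (ofReal_oscQuot_one_le_of_growth hs hns hT0.le hM0 hε0 hT hu h0 hJ x hρ).trans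
    (le_trans (ENNReal.ofReal_le_ofReal ?_) he')
  rw [← hω', ← hC, ← hp, hMε]
  have h1 : T * (2 * ρ) ^ s ≤ ε := by rw [← hTd]; gcongr
  calc lam * (T * (2 * ρ) ^ s + ε + ε) ≤ 2 * (ε + ε + ε) := by gcongr
    _ = e' := by rw [hε]; ring

/-- Passing from a bound for the critical height to a lower bound for the Young function. -/
theorem rpow_le_of_mul_rpow_le {n : ℕ} {s : ℝ} (hs : 0 < s) {a r M w : ℝ} (ha : 0 < a)
    (hr : 0 < r) (hrn : r ^ n = w⁻¹) (hw : 0 < w) (h : a * r ^ s ≤ M) :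
    a ^ ((n : ℝ) / s) ≤ M ^ ((n : ℝ) / s) * w := by
  have h1 : (a * r ^ s) ^ ((n : ℝ) / s) ≤ M ^ ((n : ℝ) / s) := by gcongr
  rw [Real.mul_rpow ha.le (by positivity), ← Real.rpow_mul hr.le, mul_div_cancel₀ _ hs.ne',
    Real.rpow_natCast, hrn, ← div_eq_mul_inv, div_le_iff₀ hw] at h1
  exact h1

theorem exists_pow_eq_inv {n : ℕ} (hn : 0 < n) {w : ℝ} (hw : 0 < w) :
    ∃ r : ℝ, 0 < r ∧ r ^ n = w⁻¹ := by
  refine ⟨w⁻¹ ^ ((n : ℝ)⁻¹), by positivity, ?_⟩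
  exact Real.rpow_inv_natCast_pow (by positivity) hn.ne'

theorem growth_of_bmo {n : ℕ} (hn : 0 < n) {s : ℝ} (hs : s ∈ Ioo (0 : ℝ) 1) {A : ℝ → ℝ≥0∞}
    (hA : IsYoung A) {c' : ℝ} (hc' : 0 < c')
    (h : ∀ u : Euc n → ℝ, Measurable u → fracSemS n s A u < ⊤ →
      campSem n (fun _ => 1) u ≤ ENNReal.ofReal c' * fracSemS n s A u) :
    ∃ c : ℝ, 0 < c ∧ ∀ t : ℝ, 0 < t → ENNReal.ofReal (c * t ^ ((n : ℝ) / s)) ≤ A t := by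
  obtain ⟨C, hC, hJ⟩ := exists_Jfun_scaledTent_le hn hs hA
  obtain ⟨c₀, hc₀, hosc⟩ := exists_oscQuot_scaledTent hn s
  have key : ∀ a r : ℝ, 0 < a → 0 < r → A a * ENNReal.ofReal (C * r ^ n) ≤ 1 →
      a * r ^ s ≤ c' / c₀ := by
    intro a r ha hr hle
    have h1 := fracSemS_le_one ((hJ a r ha hr).trans hle)
    have h2 := h _ (measurable_scaledTent n s a r) (h1.trans_lt ENNReal.one_lt_top)
    have h3 : ENNReal.ofReal (c₀ * (a * r ^ s)) ≤ campSem n (fun _ => 1) (scaledTent n s a r) := by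
      rw [← hosc a r ha hr]
      exact le_iSup_of_le 0 (le_iSup_of_le r (le_iSup_of_le hr le_rfl))
    have h4 : ENNReal.ofReal (c₀ * (a * r ^ s)) ≤ ENNReal.ofReal c' :=
      h3.trans (h2.trans (mul_le_of_le_one_right' h1))
    rw [le_div_iff₀ hc₀, mul_comm]
    exact (ENNReal.ofReal_le_ofReal_iff hc'.le).1 h4
  set M := c' / c₀ with hM
  have hM0 : 0 < M := by positivity
  refine ⟨(M ^ ((n : ℝ) / s) * C)⁻¹, by positivity, fun t ht => ?_⟩
  rcases eq_or_ne (A t) ⊤ with htop | htop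
  · simp [htop]
  rcases eq_or_ne (A t) 0 with hzero | hzero
  · have h1 := key t ((2 * M / t) ^ s⁻¹) ht (by positivity) (by simp [hzero])
    rw [← Real.rpow_mul (by positivity), inv_mul_cancel₀ hs.1.ne', Real.rpow_one,
      mul_div_cancel₀ _ ht.ne'] at h1
    linarith
  have hv : 0 < (A t).toReal := ENNReal.toReal_pos hzero htop
  set v := (A t).toReal with hv'
  have hAv : A t = ENNReal.ofReal v := (ENNReal.ofReal_toReal htop).symm
  obtain ⟨r, hr, hrn⟩ := exists_pow_eq_inv hn (mul_pos hC hv)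
  have h1 := key t r ht hr (by
    rw [hAv, hrn, ← ENNReal.ofReal_mul hv.le]
    refine ENNReal.ofReal_le_one.2 (le_of_eq ?_)
    field_simp)
  have h2 := rpow_le_of_mul_rpow_le hs.1 ht hr hrn (mul_pos hC hv) h1
  rw [hAv]
  refine ENNReal.ofReal_le_ofReal ?_
  rw [inv_mul_le_iff₀ (by positivity), mul_assoc]
  exact h2

theorem superGrowth_of_vanishing {n : ℕ} (hn : 0 < n) {s : ℝ} (hs : s ∈ Ioo (0 : ℝ) 1)
    {A : ℝ → ℝ≥0∞} (hA : IsYoung A) {c : ℝ} (hc : 0 < c)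
    (hgrowth : ∀ t : ℝ, 0 < t → ENNReal.ofReal (c * t ^ ((n : ℝ) / s)) ≤ A t)
    (h : Tendsto
      (fun r : ℝ => ⨆ (u : Euc n → ℝ) (_ : Measurable u) (_ : fracSemS n s A u ≤ 1),
        campSemSmall n (fun _ => 1) u r)
      (𝓝[>] (0 : ℝ)) (𝓝 0)) :
    Tendsto (fun t : ℝ => A t / ENNReal.ofReal (t ^ ((n : ℝ) / s))) atTop (𝓝 ⊤) := by
  obtain ⟨C, hC, hJ⟩ := exists_Jfun_scaledTent_le hn hs hA
  obtain ⟨c₀, hc₀, hosc⟩ := exists_oscQuot_scaledTent hn s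
  set ω := volume.real (ball (0 : Euc n) 1) with hω'
  have hω : 0 < ω := volume_real_unitBall_pos n
  have hs0 : 0 < s := hs.1
  set p := (n : ℝ) / s with hp
  have hp0 : 0 < p := by positivity
  refine ENNReal.tendsto_nhds_top_iff_nnreal.2 fun x => ?_
  set M := ((x + 1) * C : ℝ)⁻¹ ^ p⁻¹ with hM
  have hx0 : (0 : ℝ) ≤ x := x.2
  have hM0 : 0 < M := by positivity
  have hMp : M ^ p = ((x + 1) * C : ℝ)⁻¹ := by
    rw [hM, ← Real.rpow_mul (by positivity), inv_mul_cancel₀ hp0.ne', Real.rpow_one]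
  have hev := (ENNReal.tendsto_nhds_zero.1 h (ENNReal.ofReal (c₀ * M))
    (ENNReal.ofReal_pos.2 (by positivity))).and self_mem_nhdsWithin
  obtain ⟨δ, hδ, hδ0⟩ := hev.exists
  have hδ0 : 0 < δ := hδ0
  have htend : Tendsto (fun t : ℝ => t ^ p) atTop atTop := tendsto_rpow_atTop hp0
  filter_upwards [htend.eventually_ge_atTop (ω / (C * c * δ)), eventually_gt_atTop 0] with t ht ht0
  have htp : 0 < t ^ p := by positivity
  rcases eq_or_ne (A t) ⊤ with htop | htop
  · rw [htop, ENNReal.top_div_of_ne_top ENNReal.ofReal_ne_top]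
    exact ENNReal.coe_lt_top
  set v := (A t).toReal with hv'
  have hAv : A t = ENNReal.ofReal v := (ENNReal.ofReal_toReal htop).symm
  have hcv : c * t ^ p ≤ v := (ENNReal.ofReal_le_iff_le_toReal htop).1 (hgrowth t ht0)
  have hv : 0 < v := lt_of_lt_of_le (by positivity) hcv
  obtain ⟨r, hr, hrn⟩ := exists_pow_eq_inv hn (mul_pos hC hv)
  have hvol : volume (ball (0 : Euc n) r) ≤ ENNReal.ofReal δ := by
    rw [← ofReal_measureReal measure_ball_lt_top.ne, volume_ball_real 0 hr, hrn]
    refine ENNReal.ofReal_le_ofReal ?_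
    rw [inv_mul_le_iff₀ (by positivity), ← hω']
    rw [div_le_iff₀ (by positivity)] at ht
    calc ω ≤ t ^ p * (C * c * δ) := ht
      _ = C * (c * t ^ p) * δ := by ring
      _ ≤ C * v * δ := by gcongr
  have hfrac : fracSemS n s A (scaledTent n s t r) ≤ 1 := by
    refine fracSemS_le_one ((hJ t r ht0 hr).trans ?_)
    rw [hAv, hrn, ← ENNReal.ofReal_mul hv.le]
    refine ENNReal.ofReal_le_one.2 (le_of_eq ?_)
    field_simp
  have h1 : ENNReal.ofReal (c₀ * (t * r ^ s)) ≤ ENNReal.ofReal (c₀ * M) := by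
    refine le_trans ?_ hδ
    refine le_iSup_of_le (scaledTent n s t r) (le_iSup_of_le (measurable_scaledTent n s t r)
      (le_iSup_of_le hfrac ?_))
    rw [← hosc t r ht0 hr]
    exact le_iSup_of_le 0 (le_iSup_of_le r (le_iSup_of_le hr (le_iSup_of_le hvol le_rfl)))
  have h2 : t * r ^ s ≤ M :=
    le_of_mul_le_mul_left ((ENNReal.ofReal_le_ofReal_iff (by positivity)).1 h1) hc₀
  have h3 := rpow_le_of_mul_rpow_le hs0 ht0 hr hrn (mul_pos hC hv) h2
  rw [← hp, hMp, mul_inv, mul_assoc, inv_mul_cancel_left₀ hC.ne',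
    le_inv_mul_iff₀ (by positivity)] at h3
  rw [hAv, ← ENNReal.ofReal_div_of_pos htp, ← ENNReal.ofReal_coe_nnreal,
    ENNReal.ofReal_lt_ofReal_iff (by positivity), lt_div_iff₀ htp]
  nlinarith

/-- `V^{s,A}(ℝⁿ) → VMO(ℝⁿ)` uniformly if and only if `A(t) ≥ c t^{n/s}`
for all `t > 0` and `A(t)/t^{n/s} → ∞` as `t → ∞`. -/
theorem stmt4 (n : ℕ) (hn : 0 < n) (s : ℝ) (hs : s ∈ Set.Ioo (0 : ℝ) 1)
    (A : ℝ → ℝ≥0∞) (hA : IsYoung A) :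
    ((∃ c' : ℝ, 0 < c' ∧ ∀ u : Euc n → ℝ, Measurable u → fracSemS n s A u < ⊤ →
        campSem n (fun _ => 1) u ≤ ENNReal.ofReal c' * fracSemS n s A u) ∧
      Tendsto
        (fun r : ℝ => ⨆ (u : Euc n → ℝ) (_ : Measurable u) (_ : fracSemS n s A u ≤ 1),
          campSemSmall n (fun _ => 1) u r)
        (𝓝[>] (0 : ℝ)) (𝓝 0)) ↔
    ((∃ c : ℝ, 0 < c ∧ ∀ t : ℝ, 0 < t →
        ENNReal.ofReal (c * t ^ ((n : ℝ) / s)) ≤ A t) ∧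
      Tendsto (fun t : ℝ => A t / ENNReal.ofReal (t ^ ((n : ℝ) / s))) atTop (𝓝 ⊤)) := by
  have hns : s < n := hs.2.trans_le (by exact_mod_cast hn)
  constructor
  · rintro ⟨⟨c', hc', hbmo⟩, hvan⟩
    obtain ⟨c, hc, hgrowth⟩ := growth_of_bmo hn hs hA hc' hbmo
    exact ⟨⟨c, hc, hgrowth⟩, superGrowth_of_vanishing hn hs hA hc hgrowth hvan⟩
  · rintro ⟨⟨c, hc, hgrowth⟩, hlim⟩
    exact ⟨bmo_of_growth hs.1 hns hc hgrowth, vanishing_of_growth hs.1 hns hlim⟩
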